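/- Let 𝕂 be any field, N a finite set, and Γ a principally regular symmetric matrix over 𝕂 with rows and columns indexed by N. Then CIS(Γ) is a gaussoid over N; that is, for all distinct i, j, k ∈ N and L ⊆ N∖{i,j,k}: (i) det Γ_{ij|L} = det Γ_{ik|jL} = 0 if and only if det Γ_{ik|L} = det Γ_{ij|kL} = 0; (ii) det Γ_{ij|kL} = det Γ_{ik|jL} = 0 if and only if det Γ_{ij|L} = det Γ_{ik|L} = 0; (iii) if det Γ_{ij|L} = det Γ_{ij|kL} = 0 then det Γ_{ik|L} = 0 or det Γ_{jk|L} = 0. -/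

import Mathlib

open scoped symmDiff

abbrev CIStmt (N : Type*) := Sym2 N × Finset N

def CIStmt.proper {N : Type*} (s : CIStmt N) : Prop :=
  ¬ s.1.IsDiag ∧ ∀ i ∈ s.1, i ∉ s.2

variable {N : Type*} [DecidableEq N]

def pminor {R : Type*} [CommRing R] (M : Matrix N N R) (S : Finset N) : R :=
  (M.submatrix (fun a : S => (a : N)) (fun a : S => (a : N))).det

def apminor {R : Type*} [CommRing R] (M : Matrix N N R) (i j : N) (K : Finset N) : R :=
  (Matrix.of fun a b : Unit ⊕ ↥K =>
      M (Sum.elim (fun _ => i) (fun k => (k : N)) a)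
        (Sum.elim (fun _ => j) (fun k => (k : N)) b)).det

def PrinReg {R : Type*} [CommRing R] (M : Matrix N N R) : Prop :=
  ∀ S : Finset N, pminor M S ≠ 0

def PosDefMinors {R : Type*} [Field R] [LinearOrder R] [IsStrictOrderedRing R] (M : Matrix N N R) : Prop :=
  ∀ S : Finset N, 0 < pminor M S

def CIS {R : Type*} [CommRing R] (M : Matrix N N R) : Set (CIStmt N) :=
  {s | s.proper ∧ ∀ i j : N, s.1 = s(i, j) → apminor M i j s.2 = 0}

def IsGaussoid (G : Set (CIStmt N)) : Prop :=
  (∀ s ∈ G, s.proper) ∧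
  ∀ i j k : N, ∀ L : Finset N,
    i ≠ j → i ≠ k → j ≠ k → i ∉ L → j ∉ L → k ∉ L →
      (((s(i,j), L) ∈ G ∧ (s(i,k), insert j L) ∈ G) ↔
        ((s(i,k), L) ∈ G ∧ (s(i,j), insert k L) ∈ G)) ∧
      (((s(i,j), insert k L) ∈ G ∧ (s(i,k), insert j L) ∈ G) ↔
        ((s(i,j), L) ∈ G ∧ (s(i,k), L) ∈ G)) ∧
      (((s(i,j), L) ∈ G ∧ (s(i,j), insert k L) ∈ G) →
        ((s(i,k), L) ∈ G ∨ (s(j,k), L) ∈ G))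



/-- Schur complement entry. -/
noncomputable def schurE {𝕂 : Type*} [Field 𝕂] (M : Matrix N N 𝕂) (L : Finset N) (x y : N) : 𝕂 :=
  M x y - ((Matrix.of fun (_ : Unit) (l : L) => M x l) *
    (M.submatrix (fun a : L => (a : N)) (fun a : L => (a : N)))⁻¹ *
    (Matrix.of fun (l : L) (_ : Unit) => M l y)) () ()

lemma det_schurE {𝕂 : Type*} [Field 𝕂] (M : Matrix N N 𝕂) (L : Finset N) (h : pminor M L ≠ 0)
    {m : Type*} [Fintype m] [DecidableEq m] (f g : m → N) :
    (Matrix.of fun a b : m ⊕ ↥L =>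
      M (Sum.elim f (fun k => (k : N)) a) (Sum.elim g (fun k => (k : N)) b)).det
    = pminor M L * (Matrix.of fun a b => schurE M L (f a) (g b)).det := by
  set A := M.submatrix (fun a : L => (a : N)) (fun a : L => (a : N)) with hA
  have : Invertible A := Matrix.invertibleOfIsUnitDet A (isUnit_iff_ne_zero.mpr h)
  have e : (Matrix.of fun a b : m ⊕ ↥L =>
      M (Sum.elim f (fun k => (k : N)) a) (Sum.elim g (fun k => (k : N)) b)) =
      Matrix.fromBlocks (Matrix.of fun a b => M (f a) (g b)) (Matrix.of fun a (l : L) => M (f a) l)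
        (Matrix.of fun (l : L) b => M l (g b)) A := by
    ext a b
    rcases a with a | a <;> rcases b with b | b <;> rfl
  rw [e, Matrix.det_fromBlocks₂₂]
  congr 2
  ext a b
  simp [schurE, Matrix.mul_apply, hA]

lemma apminor_eq {𝕂 : Type*} [Field 𝕂] (M : Matrix N N 𝕂) (L : Finset N) (h : pminor M L ≠ 0)
    (i j : N) : apminor M i j L = pminor M L * schurE M L i j := by
  unfold apminor
  rw [det_schurE M L h (fun _ : Unit => i) (fun _ => j)]
  simp

lemma apminor_insert {𝕂 : Type*} [Field 𝕂] (M : Matrix N N 𝕂) (L : Finset N) (h : pminor M L ≠ 0)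
    (i j k : N) (hk : k ∉ L) : apminor M i j (insert k L) = pminor M L *
      (schurE M L i j * schurE M L k k - schurE M L i k * schurE M L k j) := by
  have key := det_schurE M L h ![i, k] ![j, k]
  rw [Matrix.det_fin_two] at key
  simp only [Matrix.of_apply, Matrix.cons_val_zero, Matrix.cons_val_one] at key
  rw [← key]
  let f : Fin 2 ⊕ L → Unit ⊕ ↥(insert k L) :=
    Sum.elim ![Sum.inl (), Sum.inr ⟨k, by simp⟩] (fun l => Sum.inr ⟨l, by simp⟩)
  have hf : Function.Bijective f := by
    constructor
    · rintro (a | a) (b | b) hab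
      · fin_cases a <;> fin_cases b <;> simp_all [f]
      · fin_cases a
        · simp [f] at hab
        · simp [f] at hab; exact absurd (hab ▸ b.2) hk
      · fin_cases b
        · simp [f] at hab
        · simp [f] at hab; exact absurd (hab ▸ a.2) hk
      · simp [f] at hab; exact congrArg _ hab
    · rintro (a | ⟨a, ha⟩)
      · exact ⟨Sum.inl 0, by simp [f]⟩
      · rcases Finset.mem_insert.mp ha with rfl | h'
        · exact ⟨Sum.inl 1, by simp [f]⟩
        · exact ⟨Sum.inr ⟨a, h'⟩, by simp [f]⟩
  unfold apminor
  rw [← Matrix.det_submatrix_equiv_self (Equiv.ofBijective f hf)]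
  congr 1
  ext a b
  rcases a with a | a <;> rcases b with b | b <;> (try fin_cases a) <;> (try fin_cases b) <;> rfl

lemma pminor_insert {𝕂 : Type*} [Field 𝕂] (M : Matrix N N 𝕂) (L : Finset N)
    (k : N) (hk : k ∉ L) : pminor M (insert k L) = apminor M k k L := by
  let f : Unit ⊕ L → ↥(insert k L) :=
    Sum.elim (fun _ => ⟨k, by simp⟩) (fun l => ⟨l, by simp⟩)
  have hf : Function.Bijective f := by
    constructor
    · rintro (a | a) (b | b) hab
      · rfl
      · simp [f] at hab; exact absurd (hab ▸ b.2) hk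
      · simp [f] at hab; exact absurd (hab ▸ a.2) hk
      · simp [f] at hab; exact congrArg _ hab
    · rintro ⟨a, ha⟩
      rcases Finset.mem_insert.mp ha with rfl | h'
      · exact ⟨Sum.inl (), by simp [f]⟩
      · exact ⟨Sum.inr ⟨a, h'⟩, by simp [f]⟩
  unfold pminor apminor
  rw [← Matrix.det_submatrix_equiv_self (Equiv.ofBijective f hf)]
  congr 1
  ext a b
  rcases a with a | a <;> rcases b with b | b <;> rfl

lemma apminor_symm {𝕂 : Type*} [Field 𝕂] (M : Matrix N N 𝕂) (hM : M.IsSymm) (L : Finset N)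
    (i j : N) : apminor M i j L = apminor M j i L := by
  unfold apminor
  rw [← Matrix.det_transpose]
  congr 1
  ext a b
  simp only [Matrix.transpose_apply, Matrix.of_apply]
  exact hM.apply _ _

lemma mem_CIS {𝕂 : Type*} [Field 𝕂] (M : Matrix N N 𝕂) (hM : M.IsSymm) (L : Finset N)
    (i j : N) (hij : i ≠ j) (hi : i ∉ L) (hj : j ∉ L) :
    ((s(i, j), L) : CIStmt N) ∈ CIS M ↔ apminor M i j L = 0 := by
  constructor
  · intro h
    exact h.2 i j rfl
  · intro h
    refine ⟨⟨by simpa using hij, ?_⟩, ?_⟩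
    · intro x hx
      rcases Sym2.mem_iff.mp hx with rfl | rfl <;> assumption
    · intro a b hab
      rcases Sym2.eq_iff.mp hab with ⟨rfl, rfl⟩ | ⟨rfl, rfl⟩
      · exact h
      · rw [apminor_symm M hM]; exact h

/-- the CI structure of a principally regular symmetric matrix over any
field is a gaussoid, spelled out in terms of almost-principal minors. -/
theorem stmt15 {N : Type*} [Fintype N] [DecidableEq N] (𝕂 : Type*) [Field 𝕂]
    (Γ : Matrix N N 𝕂) (hsym : Γ.IsSymm) (hpr : PrinReg Γ) :
    IsGaussoid (CIS Γ) ∧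
    ∀ i j k : N, ∀ L : Finset N,
      i ≠ j → i ≠ k → j ≠ k → i ∉ L → j ∉ L → k ∉ L →
        ((apminor Γ i j L = 0 ∧ apminor Γ i k (insert j L) = 0) ↔
          (apminor Γ i k L = 0 ∧ apminor Γ i j (insert k L) = 0)) ∧
        ((apminor Γ i j (insert k L) = 0 ∧ apminor Γ i k (insert j L) = 0) ↔
          (apminor Γ i j L = 0 ∧ apminor Γ i k L = 0)) ∧
        ((apminor Γ i j L = 0 ∧ apminor Γ i j (insert k L) = 0) →
          (apminor Γ i k L = 0 ∨ apminor Γ j k L = 0)) := by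
  have main : ∀ i j k : N, ∀ L : Finset N,
      i ≠ j → i ≠ k → j ≠ k → i ∉ L → j ∉ L → k ∉ L →
        ((apminor Γ i j L = 0 ∧ apminor Γ i k (insert j L) = 0) ↔
          (apminor Γ i k L = 0 ∧ apminor Γ i j (insert k L) = 0)) ∧
        ((apminor Γ i j (insert k L) = 0 ∧ apminor Γ i k (insert j L) = 0) ↔
          (apminor Γ i j L = 0 ∧ apminor Γ i k L = 0)) ∧
        ((apminor Γ i j L = 0 ∧ apminor Γ i j (insert k L) = 0) →
          (apminor Γ i k L = 0 ∨ apminor Γ j k L = 0)) := by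
    intro i j k L hij hik hjk hi hj hk
    have hL := hpr L
    have hjj := hpr (insert j L)
    have hkk := hpr (insert k L)
    have hjk2 := hpr (insert j (insert k L))
    have hs := apminor_symm Γ hsym L j k
    rw [pminor_insert _ _ _ (by simp [hjk, hj]), apminor_insert _ _ hL _ _ _ hk] at hjk2
    rw [pminor_insert _ _ _ hj, apminor_eq _ _ hL] at hjj
    rw [pminor_insert _ _ _ hk, apminor_eq _ _ hL] at hkk
    rw [apminor_eq _ _ hL, apminor_eq _ _ hL] at hs
    have hs' := mul_left_cancel₀ hL hs
    rw [apminor_insert _ _ hL _ _ _ hj, apminor_insert _ _ hL _ _ _ hk,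
      apminor_eq _ _ hL, apminor_eq _ _ hL, apminor_eq _ _ hL]
    rw [← hs'] at hjk2 ⊢
    have hjj := right_ne_zero_of_mul hjj
    have hkk := right_ne_zero_of_mul hkk
    have hd := right_ne_zero_of_mul hjk2
    simp only [mul_eq_zero, hL, false_or]
    generalize schurE Γ L i j = a at *
    generalize schurE Γ L i k = b at *
    generalize schurE Γ L j k = c at *
    generalize schurE Γ L j j = d at *
    generalize schurE Γ L k k = e at *
    refine ⟨⟨?_, ?_⟩, ⟨?_, ?_⟩, ?_⟩
    · rintro ⟨rfl, h⟩
      have hb : b = 0 := by simpa [hjj] using h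
      simp [hb]
    · rintro ⟨rfl, h⟩
      have ha : a = 0 := by simpa [hkk] using h
      simp [ha]
    · rintro ⟨h1, h2⟩
      constructor
      · refine (mul_eq_zero.mp (?_ : a * (d * e - c * c) = 0)).resolve_right hd
        linear_combination d * h1 + c * h2
      · refine (mul_eq_zero.mp (?_ : b * (d * e - c * c) = 0)).resolve_right hd
        linear_combination c * h1 + e * h2
    · rintro ⟨rfl, rfl⟩
      simp
    · rintro ⟨rfl, h⟩
      simpa using h
  refine ⟨⟨fun s hs => hs.1, ?_⟩, main⟩
  intro i j k L hij hik hjk hi hj hk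
  rw [mem_CIS Γ hsym L i j hij hi hj, mem_CIS Γ hsym L i k hik hi hk,
    mem_CIS Γ hsym L j k hjk hj hk,
    mem_CIS Γ hsym (insert j L) i k hik (by simp [hij, hi]) (by simp [hjk.symm, hk]),
    mem_CIS Γ hsym (insert k L) i j hij (by simp [hik, hi]) (by simp [hjk, hj])]
  exact main i j k L hij hik hjk hi hj hk
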